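/- For all integers t > s ≥ 0 (with the convention I^0 = R), the R-module I^s/I^t admits a free resolution of length n by free R-modules; in particular, I^s/I^t has projective dimension at most n as an R-module. -/

import Mathlib

open CategoryTheory

/-- The subquotient `I^s/I^t`, realized as a quotient of the `R`-module `I^s`
(with the convention `I^0 = R`). -/
def SubQuot (R : Type) [CommRing R] (I : Ideal R) (s t : ℕ) : Type :=
  ↥(I ^ s) ⧸ (Submodule.comap (I ^ s).subtype (I ^ t : Ideal R))

instance (R : Type) [CommRing R] (I : Ideal R) (s t : ℕ) : AddCommGroup (SubQuot R I s t) :=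
  inferInstanceAs (AddCommGroup (↥(I ^ s) ⧸ (Submodule.comap (I ^ s).subtype (I ^ t : Ideal R))))

instance (R : Type) [CommRing R] (I : Ideal R) (s t : ℕ) : Module R (SubQuot R I s t) :=
  inferInstanceAs (Module R (↥(I ^ s) ⧸ (Submodule.comap (I ^ s).subtype (I ^ t : Ideal R))))

/-- Modules with a free resolution of length at most `n`, recursively. -/
def FR (R : Type) [CommRing R] : ℕ → ∀ (M : Type) [AddCommGroup M] [Module R M], Prop
  | 0 => fun M _ _ => Module.Free R M
  | n + 1 => fun M _ _ => ∃ (K F : Type) (_ : AddCommGroup K) (_ : Module R K)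
      (_ : AddCommGroup F) (_ : Module R F) (f : K →ₗ[R] F) (g : F →ₗ[R] M),
      Module.Free R F ∧ Function.Injective f ∧ Function.Exact f g ∧ Function.Surjective g ∧ FR R n K

section
open scoped Pointwise
variable {R : Type} [CommRing R]

theorem FR_zero_of_subsingleton (n : ℕ) (M : Type) [AddCommGroup M] [Module R M]
    [Subsingleton M] : FR R n M := by
  induction n with
  | zero => exact Module.Free.of_subsingleton R M
  | succ n ih =>
    refine ⟨M, M, inferInstance, inferInstance, inferInstance, inferInstance, LinearMap.id,
      LinearMap.id, Module.Free.of_subsingleton R M, fun _ _ h => h, ?_, fun a => ⟨a, rfl⟩, ih⟩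
    intro y
    exact ⟨fun _ => ⟨y, rfl⟩, fun _ => Subsingleton.elim _ _⟩

theorem FR_succ (n : ℕ) : ∀ (M : Type) [AddCommGroup M] [Module R M], FR R n M → FR R (n+1) M := by
  induction n with
  | zero =>
    intro M _ _ h
    refine ⟨PUnit, M, inferInstance, inferInstance, inferInstance, inferInstance, 0,
      LinearMap.id, h, fun _ _ _ => rfl, ?_, fun a => ⟨a, rfl⟩, FR_zero_of_subsingleton 0 _⟩
    intro y
    constructor
    · intro h; exact ⟨0, h.symm⟩
    · rintro ⟨_, rfl⟩; rfl
  | succ n ih =>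
    rintro M _ _ ⟨K, F, _, _, _, _, f, g, h1, h2, h3, h4, h5⟩
    exact ⟨K, F, _, _, _, _, f, g, h1, h2, h3, h4, ih K h5⟩

theorem FR_ext (n : ℕ) : ∀ (A B C : Type) [AddCommGroup A] [Module R A] [AddCommGroup B]
    [Module R B] [AddCommGroup C] [Module R C] (f : A →ₗ[R] B) (g : B →ₗ[R] C),
    Function.Injective f → Function.Exact f g → Function.Surjective g →
    FR R n A → FR R n C → FR R n B := by
  induction n with
  | zero =>
    intro A B C _ _ _ _ _ _ f g hf hfg hg hA hC
    have hA : Module.Free R A := hA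
    have hC : Module.Free R C := hC
    obtain ⟨l, hl⟩ := Module.projective_lifting_property g LinearMap.id hg
    obtain ⟨e, _⟩ := (hfg.splitSurjectiveEquiv hf) ⟨l, hl⟩
    exact Module.Free.of_equiv e.symm
  | succ n ih =>
    rintro A B C _ _ _ _ _ _ f g hf hfg hg ⟨K, F, _, _, _, _, i, p, a1, a2, a3, a4, a5⟩
      ⟨K', F', _, _, _, _, i', p', b1, b2, b3, b4, b5⟩
    obtain ⟨l, hl⟩ := Module.projective_lifting_property g p' hg
    have hl' : ∀ x, g (l x) = p' x := fun x => LinearMap.congr_fun hl x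
    have gf : ∀ x, g (f x) = 0 := fun x => (hfg _).2 ⟨x, rfl⟩
    have pi0 : ∀ x, p (i x) = 0 := fun x => (a3 _).2 ⟨x, rfl⟩
    let P : F × F' →ₗ[R] B := LinearMap.coprod (f ∘ₗ p) l
    have hP : ∀ x y, P (x, y) = f (p x) + l y := fun x y => by simp [P]
    have hPs : Function.Surjective P := by
      intro b
      obtain ⟨y, hy⟩ := b4 (g b)
      have : g (b - l y) = 0 := by rw [map_sub, hl', hy, sub_self]
      obtain ⟨a, ha⟩ := (hfg _).1 this
      obtain ⟨x, hx⟩ := a4 a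
      exact ⟨(x, y), by rw [hP, hx, ha]; abel⟩
    -- kernel
    have hk : ∀ z : LinearMap.ker P, ∃ k', i' k' = z.1.2 := by
      rintro ⟨⟨x, y⟩, hz⟩
      rw [LinearMap.mem_ker, hP] at hz
      apply (b3 _).1
      have := congrArg g hz
      rwa [map_add, gf, zero_add, hl', map_zero] at this
    let u : K →ₗ[R] LinearMap.ker P :=
      LinearMap.codRestrict _ (LinearMap.inl R F F' ∘ₗ i) (fun c => by
        rw [LinearMap.mem_ker]
        simp only [LinearMap.comp_apply, LinearMap.inl_apply]
        rw [hP, pi0]; simp)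
    let e := LinearEquiv.ofInjective i' b2
    let v : LinearMap.ker P →ₗ[R] K' := e.symm.toLinearMap ∘ₗ
      LinearMap.codRestrict (LinearMap.range i') (LinearMap.snd R F F' ∘ₗ (LinearMap.ker P).subtype)
        (fun z => hk z)
    have hv : ∀ z, i' (v z) = z.1.2 := by
      intro z
      have : e (v z) = ⟨z.1.2, hk z⟩ := by
        simp only [v, LinearMap.comp_apply, LinearEquiv.coe_coe, LinearEquiv.apply_symm_apply]
        rfl
      exact congrArg Subtype.val this
    have hu : ∀ k, ((u k : LinearMap.ker P) : F × F') = (i k, 0) := fun k => rfl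
    refine ⟨LinearMap.ker P, F × F', _, _, _, _, (LinearMap.ker P).subtype, P, inferInstance,
      Subtype.val_injective, LinearMap.exact_subtype_ker_map P, hPs, ?_⟩
    refine ih K (LinearMap.ker P) K' u v ?_ ?_ ?_ a5 b5
    · intro k1 k2 h
      apply a2
      have := congrArg (fun z : LinearMap.ker P => z.1.1) h
      simpa [hu] using this
    · intro z
      constructor
      · intro h
        have h2 := hv z
        rw [h, map_zero] at h2
        have h3 := z.2
        obtain ⟨⟨x, y⟩, hz⟩ := z
        simp only at h2
        subst h2
        rw [LinearMap.mem_ker, hP, map_zero, add_zero] at hz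
        have : p x = 0 := hf (by rw [hz, map_zero])
        obtain ⟨k, rfl⟩ := (a3 _).1 this
        exact ⟨k, rfl⟩
      · rintro ⟨k, rfl⟩
        apply b2
        rw [hv, hu, map_zero]
    · intro k'
      have : g (l (i' k')) = 0 := by rw [hl']; exact (b3 _).2 ⟨k', rfl⟩
      obtain ⟨a, ha⟩ := (hfg _).1 this
      obtain ⟨x, hx⟩ := a4 a
      refine ⟨⟨(-x, i' k'), ?_⟩, ?_⟩
      · rw [LinearMap.mem_ker, hP, map_neg, map_neg, hx, ha]; abel
      · apply b2
        rw [hv]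

theorem FR_of_equiv (n : ℕ) {A B : Type} [AddCommGroup A] [Module R A] [AddCommGroup B]
    [Module R B] (e : A ≃ₗ[R] B) (h : FR R n A) : FR R n B := by
  refine FR_ext n A B PUnit e.toLinearMap 0 e.injective ?_ (fun a => ⟨0, rfl⟩) h
    (FR_zero_of_subsingleton n _)
  intro y
  exact ⟨fun _ => ⟨e.symm y, by simp⟩, fun _ => rfl⟩

theorem FR_cone (n : ℕ) (A B C : Type) [AddCommGroup A] [Module R A] [AddCommGroup B]
    [Module R B] [AddCommGroup C] [Module R C] (f : A →ₗ[R] B) (g : B →ₗ[R] C)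
    (hf : Function.Injective f) (hfg : Function.Exact f g) (hg : Function.Surjective g)
    (hA : FR R n A) (hB : FR R n B) : FR R (n+1) C := by
  cases n with
  | zero => exact ⟨A, B, _, _, _, _, f, g, hB, hf, hfg, hg, hA⟩
  | succ n =>
    obtain ⟨K, F, _, _, _, _, i, p, a1, a2, a3, a4, a5⟩ := hB
    refine ⟨LinearMap.ker (g ∘ₗ p), F, _, _, _, _, (LinearMap.ker (g ∘ₗ p)).subtype, g ∘ₗ p, a1,
      Subtype.val_injective, LinearMap.exact_subtype_ker_map _, hg.comp a4, ?_⟩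
    have pi0 : ∀ x, p (i x) = 0 := fun x => (a3 _).2 ⟨x, rfl⟩
    let u : K →ₗ[R] LinearMap.ker (g ∘ₗ p) := LinearMap.codRestrict _ i (fun c => by
      simp [pi0])
    have hk : ∀ z : LinearMap.ker (g ∘ₗ p), p z.1 ∈ LinearMap.range f := fun z =>
      (hfg _).1 z.2
    let e := LinearEquiv.ofInjective f hf
    let v : LinearMap.ker (g ∘ₗ p) →ₗ[R] A := e.symm.toLinearMap ∘ₗ
      LinearMap.codRestrict (LinearMap.range f) (p ∘ₗ (LinearMap.ker (g ∘ₗ p)).subtype) hk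
    have hv : ∀ z, f (v z) = p z.1 := by
      intro z
      have : e (v z) = ⟨p z.1, hk z⟩ := by
        simp only [v, LinearMap.comp_apply, LinearEquiv.coe_coe, LinearEquiv.apply_symm_apply]
        rfl
      exact congrArg Subtype.val this
    refine FR_ext (n+1) K _ A u v ?_ ?_ ?_ (FR_succ n K a5) hA
    · intro k1 k2 h
      exact a2 (congrArg Subtype.val h)
    · intro z
      constructor
      · intro h
        have h2 := hv z
        rw [h, map_zero] at h2
        obtain ⟨k, hk⟩ := (a3 _).1 h2.symm
        exact ⟨k, Subtype.ext hk⟩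
      · rintro ⟨k, rfl⟩
        apply hf
        rw [hv, map_zero]
        exact pi0 k
    · intro a
      obtain ⟨x, hx⟩ := a4 (f a)
      refine ⟨⟨x, ?_⟩, hf ?_⟩
      · rw [LinearMap.mem_ker, LinearMap.comp_apply, hx]; exact (hfg _).2 ⟨a, rfl⟩
      · rw [hv, hx]

universe v

theorem FR_resolution (n : ℕ) : ∀ (M : Type) [AddCommGroup M] [Module R M], FR R n M →
    ∃ (F : ℕ → ModuleCat.{v} R) (d : ∀ i : ℕ, F (i + 1) →ₗ[R] F i)
      (ε : F 0 →ₗ[R] M),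
      (∀ i, Module.Free R (F i)) ∧
      (∀ i, n < i → Subsingleton (F i)) ∧
      Function.Surjective ε ∧
      Function.Exact (d 0) ε ∧
      (∀ i, Function.Exact (d (i + 1)) (d i)) := by
  induction n with
  | zero =>
    intro M _ _ h
    have h : Module.Free R M := h
    refine ⟨fun i => Nat.casesOn i (ModuleCat.of R (ULift.{v} M))
      (fun _ => ModuleCat.of R PUnit), fun i => 0,
      (ULift.moduleEquiv : ULift.{v} M ≃ₗ[R] M).toLinearMap, ?_, ?_, ?_, ?_, ?_⟩
    · rintro (_ | i)
      · exact Module.Free.of_equiv (ULift.moduleEquiv : ULift.{v} M ≃ₗ[R] M).symm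
      · exact Module.Free.of_subsingleton R PUnit.{v+1}
    · rintro (_ | i) hi
      · omega
      · exact inferInstanceAs (Subsingleton PUnit.{v+1})
    · exact (ULift.moduleEquiv : ULift.{v} M ≃ₗ[R] M).surjective
    · intro y
      constructor
      · intro h
        exact ⟨0, ((ULift.moduleEquiv : ULift.{v} M ≃ₗ[R] M).injective
          (h.trans (map_zero _).symm)).symm⟩
      · rintro ⟨_, rfl⟩
        rfl
    · intro i y
      exact ⟨fun _ => ⟨PUnit.unit, Subsingleton.elim (α := PUnit) _ _⟩, fun _ => rfl⟩
  | succ n ih =>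
    rintro M _ _ ⟨K, F, _, _, _, _, f, g, h1, h2, h3, h4, h5⟩
    obtain ⟨F', d, ε, a1, a2, a3, a4, a5⟩ := ih K h5
    let e : ULift.{v} F ≃ₗ[R] F := ULift.moduleEquiv
    refine ⟨fun i => Nat.casesOn i (ModuleCat.of R (ULift.{v} F)) F',
      fun i => match i with
        | 0 => (e.symm.toLinearMap ∘ₗ f ∘ₗ ε : F' 0 →ₗ[R] ULift.{v} F)
        | i + 1 => d i,
      g ∘ₗ e.toLinearMap, ?_, ?_, ?_, ?_, ?_⟩
    · rintro (_ | i)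
      · exact Module.Free.of_equiv e.symm
      · exact a1 i
    · rintro (_ | i) hi
      · omega
      · exact a2 i (by omega)
    · exact h4.comp e.surjective
    · intro y
      constructor
      · intro h
        obtain ⟨k, hk⟩ := (h3 _).1 h
        obtain ⟨w, rfl⟩ := a3 k
        refine ⟨w, ?_⟩
        change e.symm (f (ε w)) = y
        rw [hk]
        exact e.symm_apply_apply y
      · rintro ⟨w, rfl⟩
        change g (e (e.symm (f (ε w)))) = 0
        rw [e.apply_symm_apply]
        exact (h3 _).2 ⟨_, rfl⟩
    · rintro (_ | i)
      · intro y
        refine Iff.trans ?_ (a4 y)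
        change e.symm (f (ε y)) = 0 ↔ _
        rw [LinearEquiv.map_eq_zero_iff, map_eq_zero_iff f h2]
      · exact a5 i

/-- Modules built from `R ⧸ J` by finitely many extensions. -/
inductive Filt (J : Ideal R) : ∀ (M : Type) [AddCommGroup M] [Module R M], Prop
  | zero (M : Type) [AddCommGroup M] [Module R M] [Subsingleton M] : Filt J M
  | base : Filt J (R ⧸ J)
  | ext (A B C : Type) [AddCommGroup A] [Module R A] [AddCommGroup B]
    [Module R B] [AddCommGroup C] [Module R C] (f : A →ₗ[R] B) (g : B →ₗ[R] C)
    (hf : Function.Injective f) (hfg : Function.Exact f g) (hg : Function.Surjective g)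
    (hA : Filt J A) (hC : Filt J C) : Filt J B

theorem Filt.of_equiv {J : Ideal R} {A B : Type} [AddCommGroup A] [Module R A] [AddCommGroup B]
    [Module R B] (e : A ≃ₗ[R] B) (h : Filt J A) : Filt J B := by
  refine Filt.ext A B PUnit e.toLinearMap 0 e.injective ?_ (fun a => ⟨0, rfl⟩) h
    (Filt.zero _)
  intro y
  exact ⟨fun _ => ⟨e.symm y, by simp⟩, fun _ => rfl⟩

theorem Filt.fr {J : Ideal R} {n : ℕ} (hJ : FR R n (R ⧸ J)) {M : Type} [AddCommGroup M]
    [Module R M] (h : Filt J M) : FR R n M := by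
  induction h with
  | zero M => exact FR_zero_of_subsingleton n M
  | base => exact hJ
  | ext A B C f g hf hfg hg _ _ ihA ihC => exact FR_ext n A B C f g hf hfg hg ihA ihC

theorem Filt.reg {J : Ideal R} {x : R} (hJ : IsSMulRegular (R ⧸ J) x) {M : Type} [AddCommGroup M]
    [Module R M] (h : Filt J M) : IsSMulRegular M x := by
  induction h with
  | zero M => exact fun _ _ _ => Subsingleton.elim _ _
  | base => exact hJ
  | ext A B C f g hf hfg hg _ _ ihA ihC =>
    rw [isSMulRegular_iff_right_eq_zero_of_smul] at *
    intro b hb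
    have : g b = 0 := ihC _ (by rw [← map_smul, hb, map_zero])
    obtain ⟨a, rfl⟩ := (hfg _).1 this
    rw [← map_smul, map_eq_zero_iff f hf] at hb
    rw [ihA a hb, map_zero]

theorem base_quot_equiv (J : Ideal R) (x : R) :
    Nonempty (QuotSMulTop x (R ⧸ J) ≃ₗ[R] R ⧸ (J ⊔ Ideal.span {x})) := by
  let φ : R →ₗ[R] QuotSMulTop x (R ⧸ J) := (Submodule.mkQ _) ∘ₗ (Submodule.mkQ J)
  have hs : Function.Surjective φ := (Submodule.mkQ_surjective _).comp (Submodule.mkQ_surjective _)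
  have hk : LinearMap.ker φ = J ⊔ Ideal.span {x} := by
    ext a
    simp only [φ, LinearMap.mem_ker, LinearMap.comp_apply, Submodule.mkQ_apply,
      Submodule.Quotient.mk_eq_zero]
    rw [Submodule.mem_smul_pointwise_iff_exists, Submodule.mem_sup]
    constructor
    · rintro ⟨b, -, hb⟩
      obtain ⟨b, rfl⟩ := Submodule.mkQ_surjective J b
      rw [← map_smul, Submodule.mkQ_apply, Submodule.Quotient.eq] at hb
      refine ⟨-(x • b - a), J.neg_mem hb, x * b, Ideal.mem_span_singleton'.2 ⟨b, mul_comm _ _⟩, ?_⟩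
      simp
    · rintro ⟨y, hy, z, hz, rfl⟩
      obtain ⟨b, rfl⟩ := Ideal.mem_span_singleton'.1 hz
      refine ⟨Submodule.Quotient.mk b, trivial, ?_⟩
      rw [← Submodule.Quotient.mk_smul, Submodule.Quotient.eq, smul_eq_mul, mul_comm x b]
      simpa using hy
  exact ⟨((Submodule.quotEquivOfEq _ _ hk).symm.trans (φ.quotKerEquivOfSurjective hs)).symm⟩

theorem Filt.quot {J : Ideal R} {x : R} (hJ : IsSMulRegular (R ⧸ J) x) {M : Type} [AddCommGroup M]
    [Module R M] (h : Filt J M) : Filt (J ⊔ Ideal.span {x}) (QuotSMulTop x M) := by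
  induction h with
  | zero M => exact Filt.zero _
  | base => exact Filt.of_equiv (base_quot_equiv J x).some.symm Filt.base
  | ext A B C f g hf hfg hg hA hC ihA ihC =>
    refine Filt.ext _ _ _ (QuotSMulTop.map x f) (QuotSMulTop.map x g) ?_
      (QuotSMulTop.map_exact x hfg hg) (QuotSMulTop.map_surjective x hg) ihA ihC
    have h0 : Function.Exact (0 : PUnit.{1} →ₗ[R] A) f := by
      intro y
      rw [map_eq_zero_iff f hf]
      constructor
      · intro h; exact ⟨0, h.symm⟩
      · rintro ⟨_, rfl⟩; rfl
    have := QuotSMulTop.map_first_exact_on_four_term_exact_of_isSMulRegular_last h0 hfg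
      (hC.reg hJ)
    rw [injective_iff_map_eq_zero]
    intro a ha
    obtain ⟨b, hb⟩ := (this a).1 ha
    rw [← hb, map_zero]; rfl

theorem FR_quot {J : Ideal R} {x : R} {n : ℕ} (hJ : IsSMulRegular (R ⧸ J) x)
    (h : FR R n (R ⧸ J)) : FR R (n+1) (R ⧸ (J ⊔ Ideal.span {x})) := by
  refine FR_of_equiv _ (base_quot_equiv J x).some ?_
  refine FR_cone n (R ⧸ J) (R ⧸ J) _ (LinearMap.lsmul R (R ⧸ J) x) (Submodule.mkQ _) hJ ?_
    (Submodule.mkQ_surjective _) h h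
  intro y
  rw [Submodule.mkQ_apply, Submodule.Quotient.mk_eq_zero,
    Submodule.mem_smul_pointwise_iff_exists]
  simp

/-- subquotient of ideals -/
abbrev SQ (M N : Ideal R) : Type := ↥M ⧸ (Submodule.comap M.subtype N)

def sqMk {M : Ideal R} (N : Ideal R) (a : R) (h : a ∈ M) : SQ M N := Submodule.Quotient.mk ⟨a, h⟩

theorem sq_ind {M N : Ideal R} (z : SQ M N) : ∃ a h, z = sqMk N a h := by
  obtain ⟨⟨a, h⟩, rfl⟩ := Submodule.mkQ_surjective _ z
  exact ⟨a, h, rfl⟩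

theorem sqMk_eq {M N : Ideal R} {a b : R} {h : a ∈ M} {h' : b ∈ M} :
    sqMk N a h = sqMk N b h' ↔ a - b ∈ N := by
  unfold sqMk
  rw [Submodule.Quotient.eq]; rfl

theorem sqMk_eq_zero {M N : Ideal R} {a : R} {h : a ∈ M} :
    sqMk N a h = 0 ↔ a ∈ N := by
  unfold sqMk
  rw [Submodule.Quotient.mk_eq_zero]; rfl

theorem smul_sqMk {M N : Ideal R} {a x : R} {h : a ∈ M} :
    x • sqMk N a h = sqMk N (x * a) (M.mul_mem_left x h) := rfl

def sqMap {M N M' N' : Ideal R} (x : R) (h : ∀ a ∈ M, x * a ∈ M') (h' : ∀ a ∈ N, x * a ∈ N') :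
    SQ M N →ₗ[R] SQ M' N' :=
  Submodule.mapQ _ _ ((LinearMap.lsmul R R x).restrict h) (fun a ha => h' _ ha)

theorem sqMap_mk {M N M' N' : Ideal R} (x : R) (h : ∀ a ∈ M, x * a ∈ M')
    (h' : ∀ a ∈ N, x * a ∈ N') (a : R) (ha : a ∈ M) :
    sqMap x h h' (sqMk N a ha) = sqMk N' (x * a) (h a ha) := rfl

theorem reg_pow {J : Ideal R} {x : R} (hx : IsSMulRegular (R ⧸ J) x)
    (hJ : ∀ d, Filt J (SQ (J ^ d) (J ^ (d+1)))) (k : ℕ) : ∀ a, x * a ∈ J ^ k → a ∈ J ^ k := by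
  induction k with
  | zero => intro a _; simp
  | succ k ih =>
    intro a ha
    have h1 := ih a (Ideal.pow_le_pow_right (Nat.le_succ k) ha)
    have h2 := (isSMulRegular_iff_right_eq_zero_of_smul.1 ((hJ k).reg hx)) (sqMk _ a h1)
      (by rw [smul_sqMk, sqMk_eq_zero]; exact ha)
    exact sqMk_eq_zero.1 h2

theorem sup_pow (J : Ideal R) (x : R) (d : ℕ) : (J ⊔ Ideal.span {x}) ^ (d+1) =
    J ^ (d+1) ⊔ Ideal.span {x} * (J ⊔ Ideal.span {x}) ^ d := by
  induction d with
  | zero => simp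
  | succ d ih =>
    have hle : J ^ (d+1) ≤ (J ⊔ Ideal.span {x}) ^ (d+1) := Ideal.pow_right_mono le_sup_left _
    rw [pow_succ, ih, Ideal.sup_mul, Ideal.mul_sup (J ^ (d+1)), ← pow_succ, mul_assoc, ← pow_succ,
      sup_assoc, ← ih]
    congr 1
    rw [mul_comm]
    exact sup_eq_right.2 (Ideal.mul_mono_right hle)

theorem mem_sup_pow {J : Ideal R} {x : R} {d : ℕ} {a : R}
    (h : a ∈ (J ⊔ Ideal.span {x}) ^ (d+1)) :
    ∃ b ∈ J ^ (d+1), ∃ c ∈ (J ⊔ Ideal.span {x}) ^ d, a = b + x * c := by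
  rw [sup_pow, Submodule.mem_sup] at h
  obtain ⟨b, hb, z, hz, rfl⟩ := h
  obtain ⟨c, hc, rfl⟩ := Ideal.mem_span_singleton_mul.1 hz
  exact ⟨b, hb, c, hc, rfl⟩

theorem sq_top_equiv (J : Ideal R) : Nonempty ((R ⧸ J) ≃ₗ[R] SQ (J ^ 0) (J ^ 1)) := by
  let φ : R →ₗ[R] SQ (J ^ 0) (J ^ 1) := Submodule.mkQ _ ∘ₗ
    LinearMap.codRestrict (J ^ 0) LinearMap.id (fun c => by simp)
  have hφ : ∀ a, φ a = sqMk _ a (by simp) := fun a => rfl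
  have hs : Function.Surjective φ := by
    intro z
    obtain ⟨a, h, rfl⟩ := sq_ind z
    exact ⟨a, rfl⟩
  have hk : LinearMap.ker φ = J := by
    ext a
    rw [LinearMap.mem_ker, hφ, sqMk_eq_zero, pow_one]
  exact ⟨(Submodule.quotEquivOfEq _ _ hk).symm.trans (φ.quotKerEquivOfSurjective hs)⟩

theorem step {J : Ideal R} {x : R} (hx : IsSMulRegular (R ⧸ J) x)
    (hJ : ∀ d, Filt J (SQ (J ^ d) (J ^ (d+1)))) (d : ℕ) :
    Filt (J ⊔ Ideal.span {x})
      (SQ ((J ⊔ Ideal.span {x}) ^ d) ((J ⊔ Ideal.span {x}) ^ (d+1))) := by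
  have hreg := reg_pow hx hJ
  have hmem := fun d a => @mem_sup_pow R _ J x d a
  have hq := fun d => Filt.quot hx (hJ d)
  have hxI : x ∈ J ⊔ Ideal.span {x} := Ideal.mem_sup_right (Ideal.mem_span_singleton_self x)
  have hJI : J ≤ J ⊔ Ideal.span {x} := le_sup_left
  generalize J ⊔ Ideal.span {x} = I at *
  have hJI : ∀ k, J ^ k ≤ I ^ k := fun k => Ideal.pow_right_mono hJI k
  have hI : ∀ k, I ^ (k+1) ≤ I ^ k := fun k => Ideal.pow_le_pow_right (Nat.le_succ k)
  have hxm : ∀ k, ∀ a ∈ I ^ k, x * a ∈ I ^ (k+1) := fun k a ha => by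
    rw [pow_succ']; exact Ideal.mul_mem_mul hxI ha
  induction d with
  | zero => exact Filt.of_equiv (sq_top_equiv I).some Filt.base
  | succ d ih =>
    let f : SQ (I ^ d) (I ^ (d+1)) →ₗ[R] SQ (I ^ (d+1)) (I ^ (d+1+1)) :=
      sqMap x (hxm d) (hxm (d+1))
    have hf : Function.Injective f := by
      rw [injective_iff_map_eq_zero]
      intro z hz
      obtain ⟨c, hc, rfl⟩ := sq_ind z
      rw [sqMap_mk, sqMk_eq_zero] at hz
      obtain ⟨b, hb, e, he, h⟩ := hmem _ _ hz
      have h1 : c - e ∈ J ^ (d+1+1) := hreg _ _ (by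
        rw [mul_sub, h, add_sub_cancel_right]; exact hb)
      have h2 := hI _ (hJI _ h1)
      rw [sqMk_eq_zero]
      simpa using Ideal.add_mem _ h2 he
    refine Filt.ext _ _ _ f (Submodule.mkQ (LinearMap.range f)) hf
      (LinearMap.exact_map_mkQ_range f) (Submodule.mkQ_surjective _) ih ?_
    let j : SQ (J ^ (d+1)) (J ^ (d+1+1)) →ₗ[R] SQ (I ^ (d+1)) (I ^ (d+1+1)) :=
      sqMap 1 (fun a ha => by rw [one_mul]; exact hJI _ ha)
        (fun a ha => by rw [one_mul]; exact hJI _ ha)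
    have hj : ∀ a ha, j (sqMk _ a ha) = sqMk _ a (hJI _ ha) := fun a ha => by
      rw [sqMap_mk, sqMk_eq]; simp
    let φ := Submodule.mkQ (LinearMap.range f) ∘ₗ j
    have hs : Function.Surjective φ := by
      intro z
      obtain ⟨z, rfl⟩ := Submodule.mkQ_surjective _ z
      obtain ⟨a, ha, rfl⟩ := sq_ind z
      obtain ⟨b, hb, c, hc, h⟩ := hmem _ _ ha
      refine ⟨sqMk _ b hb, ?_⟩
      simp only [φ, LinearMap.comp_apply, Submodule.mkQ_apply]
      rw [Submodule.Quotient.eq, hj]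
      refine ⟨sqMk _ (-c) (Ideal.neg_mem_iff _ |>.2 hc), ?_⟩
      rw [sqMap_mk]
      refine Eq.trans (sqMk_eq (h' := Ideal.sub_mem _ (hJI _ hb) ha).2 ?_) rfl
      rw [h]
      convert Ideal.zero_mem _ using 1
      ring
    have hk : LinearMap.ker φ =
        x • (⊤ : Submodule R (SQ (J ^ (d+1)) (J ^ (d+1+1)))) := by
      ext z
      obtain ⟨b, hb, rfl⟩ := sq_ind z
      simp only [φ, LinearMap.mem_ker, LinearMap.comp_apply, Submodule.mkQ_apply,
        Submodule.Quotient.mk_eq_zero]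
      rw [hj, Submodule.mem_smul_pointwise_iff_exists]
      constructor
      · rintro ⟨w, hw⟩
        obtain ⟨c, hc, rfl⟩ := sq_ind w
        rw [sqMap_mk, eq_comm, sqMk_eq] at hw
        obtain ⟨b', hb', c', hc', h⟩ := hmem _ _ hw
        have h1 : b - b' = x * (c + c') := by linear_combination h
        have h2 : c + c' ∈ J ^ (d+1) := hreg _ _ (by
          rw [← h1]; exact Ideal.sub_mem _ hb (Ideal.pow_le_pow_right (Nat.le_succ _) hb'))
        refine ⟨sqMk _ _ h2, trivial, ?_⟩
        rw [smul_sqMk, sqMk_eq, ← h1]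
        simpa using hb'
      · rintro ⟨w, -, hw⟩
        obtain ⟨c, hc, rfl⟩ := sq_ind w
        rw [smul_sqMk, sqMk_eq] at hw
        refine ⟨sqMk _ c (hI _ (hJI _ hc)), ?_⟩
        rw [sqMap_mk, sqMk_eq]
        exact hJI _ hw
    exact Filt.of_equiv ((Submodule.quotEquivOfEq _ _ hk).symm.trans
      (φ.quotKerEquivOfSurjective hs)) (hq (d+1))

theorem filt_sq {I : Ideal R} (h : ∀ d, Filt I (SQ (I ^ d) (I ^ (d+1)))) (s k : ℕ) :
    Filt I (SQ (I ^ s) (I ^ (s + k))) := by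
  induction k with
  | zero =>
    have : Subsingleton (SQ (I ^ s) (I ^ (s+0))) := by
      constructor
      intro a b
      obtain ⟨a, ha, rfl⟩ := sq_ind a
      obtain ⟨b, hb, rfl⟩ := sq_ind b
      rw [sqMk_eq]
      exact Ideal.sub_mem _ ha hb
    exact Filt.zero _
  | succ k ih =>
    have h1 : I ^ (s+k) ≤ I ^ s := Ideal.pow_le_pow_right (by omega)
    have h2 : I ^ (s+k+1) ≤ I ^ (s+k) := Ideal.pow_le_pow_right (by omega)
    let f : SQ (I ^ (s+k)) (I ^ (s+k+1)) →ₗ[R] SQ (I ^ s) (I ^ (s+(k+1))) :=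
      sqMap 1 (fun a ha => by rw [one_mul]; exact h1 ha) (fun a ha => by rw [one_mul]; exact ha)
    let g : SQ (I ^ s) (I ^ (s+(k+1))) →ₗ[R] SQ (I ^ s) (I ^ (s+k)) :=
      sqMap 1 (fun a ha => by rw [one_mul]; exact ha) (fun a ha => by rw [one_mul]; exact h2 ha)
    refine Filt.ext _ _ _ f g ?_ ?_ ?_ (h (s+k)) ih
    · rw [injective_iff_map_eq_zero]
      intro z hz
      obtain ⟨a, ha, rfl⟩ := sq_ind z
      rw [sqMap_mk, sqMk_eq_zero, one_mul] at hz
      exact sqMk_eq_zero.2 hz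
    · intro z
      obtain ⟨a, ha, rfl⟩ := sq_ind z
      rw [sqMap_mk, sqMk_eq_zero, one_mul]
      constructor
      · intro h
        refine ⟨sqMk _ a h, ?_⟩
        rw [sqMap_mk, sqMk_eq]; simp
      · rintro ⟨w, hw⟩
        obtain ⟨b, hb, rfl⟩ := sq_ind w
        rw [sqMap_mk, sqMk_eq, one_mul] at hw
        have := Ideal.sub_mem _ hb (h2 hw)
        simpa using this
    · intro z
      obtain ⟨a, ha, rfl⟩ := sq_ind z
      refine ⟨sqMk _ a ha, ?_⟩
      rw [sqMap_mk, sqMk_eq]; simp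

theorem bot_case (d : ℕ) : Filt (⊥ : Ideal R) (SQ ((⊥ : Ideal R) ^ d) (⊥ ^ (d+1))) := by
  cases d with
  | zero => exact Filt.of_equiv (sq_top_equiv ⊥).some Filt.base
  | succ d =>
    have : Subsingleton (SQ ((⊥ : Ideal R) ^ (d+1)) (⊥ ^ (d+1+1))) := by
      constructor
      intro a b
      obtain ⟨a, ha, rfl⟩ := sq_ind a
      obtain ⟨b, hb, rfl⟩ := sq_ind b
      rw [sqMk_eq]
      have e : ∀ k, (⊥ : Ideal R) ^ (k+1) = ⊥ := fun k => by
        rw [pow_succ, Ideal.mul_bot]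
      rw [e] at *
      exact Ideal.sub_mem _ ha hb
    exact Filt.zero _

theorem main_list (rs : List R) (h : RingTheory.Sequence.IsWeaklyRegular R rs) (i : ℕ)
    (hi : i ≤ rs.length) :
    (∀ d, Filt (Ideal.ofList (rs.take i))
      (SQ ((Ideal.ofList (rs.take i)) ^ d) ((Ideal.ofList (rs.take i)) ^ (d+1)))) ∧
    FR R i (R ⧸ Ideal.ofList (rs.take i)) := by
  induction i with
  | zero =>
    rw [List.take_zero, Ideal.ofList_nil]
    refine ⟨bot_case, ?_⟩
    exact Module.Free.of_equiv (Submodule.quotEquivOfEqBot (⊥ : Ideal R) rfl).symm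
  | succ i ih =>
    obtain ⟨h1, h2⟩ := ih (by omega)
    have hx := h.regular_mod_prev i (by omega)
    rw [smul_eq_mul, Ideal.mul_top] at hx
    rw [List.take_succ_eq_append_getElem (by omega), Ideal.ofList_append, Ideal.ofList_singleton]
    exact ⟨step hx h1, FR_quot hx h2⟩

end

/-- Let `r : Fin n → R` be a regular sequence generating the ideal `I`.
For all `t > s ≥ 0`, the `R`-module `I^s/I^t` admits a free resolution of length `n` by free
`R`-modules (in particular, its projective dimension is at most `n`). -/
theorem stmt_2 (R : Type) [CommRing R] {n : ℕ} (r : Fin n → R)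
    (hreg : RingTheory.Sequence.IsRegular R (List.ofFn r))
    (I : Ideal R) (hI : I = Ideal.span (Set.range r)) (s t : ℕ) (hst : s < t) :
    ∃ (F : ℕ → ModuleCat R) (d : ∀ i : ℕ, F (i + 1) →ₗ[R] F i)
      (ε : F 0 →ₗ[R] SubQuot R I s t),
      (∀ i, Module.Free R (F i)) ∧
      (∀ i, n < i → Subsingleton (F i)) ∧
      Function.Surjective ε ∧
      Function.Exact (d 0) ε ∧
      (∀ i, Function.Exact (d (i + 1)) (d i)) := by
  have h := main_list (List.ofFn r) hreg.toIsWeaklyRegular n (by simp)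
  have e : Ideal.ofList ((List.ofFn r).take n) = I := by
    rw [hI, List.take_of_length_le (by simp)]
    have : {a | a ∈ List.ofFn r} = Set.range r := by
      ext a
      simp [List.mem_ofFn, Set.mem_range]
    exact congrArg Ideal.span this
  rw [e] at h
  obtain ⟨k, rfl⟩ := Nat.exists_eq_add_of_lt hst
  exact FR_resolution n (SubQuot R I s (s + k + 1)) ((filt_sq h.1 s (k+1)).fr h.2)
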